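/- Let x ∈ {0,1}^ℤ and k ≥ 1. Place a marker at position n of row k iff there exists i ∈ [n-k+1, n] such that the block x[n, n+k) lexicographically dominates each of the blocks x[i, i+k), x[i+1, i+k+1), ..., x[i+k-1, i+2k-1). Then every marker position in row k+1 is also a marker position in row k. -/

import Mathlib

/-- `a` dominates `b`: either `a = b`, or at the first index where they differ `a` has `1`
(`true`) and `b` has `0` (`false`). This is the lexicographic order on binary blocks. -/
def Dom {k : ℕ} (a b : Fin k → Bool) : Prop :=
  a = b ∨ ∃ i : Fin k, (∀ j : Fin k, j < i → a j = b j) ∧ a i = true ∧ b i = false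

/-- The block `x[n, n+k)` of a bi-infinite binary sequence. -/
def block (x : ℤ → Bool) (n : ℤ) (k : ℕ) : Fin k → Bool :=
  fun t => x (n + (t : ℕ))

/-- A marker at position `n` in row `k`: there is a window `[i, i+k)` of length `k`
containing `n` such that `x[n, n+k)` dominates all the blocks `x[j, j+k)`, `j` in the
window. -/
def Marker (x : ℤ → Bool) (k : ℕ) (n : ℤ) : Prop :=
  ∃ i : ℤ, n - k + 1 ≤ i ∧ i ≤ n ∧
    ∀ j : ℤ, i ≤ j → j < i + k → Dom (block x n k) (block x j k)

/-- Domination passes to prefixes. -/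
theorem Dom.of_succ {x : ℤ → Bool} {k : ℕ} {m n : ℤ}
    (h : Dom (block x m (k + 1)) (block x n (k + 1))) : Dom (block x m k) (block x n k) := by
  rcases h with h | ⟨i, heq, hm, hn⟩
  · exact Or.inl (funext fun t => congrFun h t.castSucc)
  · induction i using Fin.lastCases with
    | last => exact Or.inl (funext fun t => heq t.castSucc t.castSucc_lt_last)
    | cast i =>
      exact Or.inr ⟨i, fun j hj => heq j.castSucc (Fin.castSucc_lt_castSucc_iff.2 hj), hm, hn⟩

/-- Every marker position of row `k+1` is also a marker position of row `k`. -/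
theorem stmt11 (x : ℤ → Bool) (k : ℕ) (hk : 1 ≤ k) (n : ℤ)
    (h : Marker x (k + 1) n) : Marker x k n := by
  obtain ⟨i, h₁, h₂, hdom⟩ := h
  push_cast at h₁ hdom
  by_cases hi : n - k + 1 ≤ i
  · exact ⟨i, hi, h₂, fun j hj hj' => (hdom j hj (by omega)).of_succ⟩
  · exact ⟨i + 1, by omega, by omega, fun j hj hj' => (hdom j (by omega) (by omega)).of_succ⟩
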